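/- Let n ≥ 2, let μ : Fin n → ℝ satisfy 0 ≤ μ_j for all j and ∑_j μ_j = 1, and set v = ∑_j μ_j e_j where (e_1, …, e_n) is the standard basis of ℝ^n. Let S be the convex hull of {e_1, …, e_n} and, for each j, let A_j be the convex hull of {e_k : k ≠ j} ∪ {v}. Then for every j, the (n−1)-dimensional Hausdorff measure of A_j equals μ_j times the (n−1)-dimensional Hausdorff measure of S, i.e. H^{n−1}(A_j) = μ_j · H^{n−1}(S). -/

import Mathlib

open MeasureTheory

open Module in
/-- On a finite-dimensional real inner product space, let `φ` be a nonzero linear form and `w` a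
vector of its kernel. The transvection `x ↦ x + f x • w` fixing `p` multiplies the Hausdorff
measure of codimension one by `|1 + f w|` on subsets of the hyperplane `φ = φ p`. -/
theorem hausdorffMeasure_image_transvection_of_subset_hyperplane {E : Type*}
    [NormedAddCommGroup E] [InnerProductSpace ℝ E] [FiniteDimensional ℝ E]
    [MeasurableSpace E] [BorelSpace E] {φ : E →ₗ[ℝ] ℝ} (hφ : φ ≠ 0) (f : E →ₗ[ℝ] ℝ)
    {p w : E} (hw : φ w = 0) (hp : f p = 0) {s : Set E} (hs : ∀ x ∈ s, φ x = φ p) :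
    Measure.hausdorffMeasure ((finrank ℝ E : ℝ) - 1) (LinearMap.transvection f w '' s)
      = ENNReal.ofReal |1 + f w| * Measure.hausdorffMeasure ((finrank ℝ E : ℝ) - 1) s := by
  let W := LinearMap.ker φ
  have hdim : (finrank ℝ E : ℝ) - 1 = finrank ℝ W := by
    have h : finrank ℝ W + 1 = finrank ℝ E := Module.Dual.finrank_ker_add_one_of_ne_zero hφ
    rw [← h]
    push_cast
    ring
  let g : W → E := fun y => p + y
  have hg : Isometry g := (isometry_add_left p).comp isometry_subtype_coe
  let T : W →ₗ[ℝ] W := LinearMap.transvection (f ∘ₗ W.subtype) ⟨w, hw⟩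
  have hT : LinearMap.det T = 1 + f w := LinearMap.transvection.det _ _
  have hsg : g '' (g ⁻¹' s) = s := by
    refine Set.image_preimage_eq_of_subset fun x hx => ⟨⟨x - p, ?_⟩, ?_⟩
    · simp [W, hs x hx]
    · simp [g]
  have himage : LinearMap.transvection f w '' s = g '' (T '' (g ⁻¹' s)) := by
    conv_lhs => rw [← hsg]
    simp only [Set.image_image]
    refine Set.image_congr fun y _ => ?_
    simp [g, T, LinearMap.transvection.apply, hp, add_assoc]
  rw [himage, hdim, hg.hausdorffMeasure_image (Or.inl (Nat.cast_nonneg _)),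
    Measure.addHaar_image_linearMap, hT,
    ← hg.hausdorffMeasure_image (Or.inl (Nat.cast_nonneg _)) (g ⁻¹' s), hsg]

/-- With `S` the standard simplex (convex hull of the standard basis of `ℝ^n`)
and `A j` the convex hull of `{e k : k ≠ j} ∪ {v}`, where `v = ∑ j, μ j • e j` for a
nonnegative `μ` summing to `1` and `n ≥ 2`, the `(n-1)`-dimensional Hausdorff measure
satisfies `H^{n-1}(A j) = μ j * H^{n-1}(S)`. -/
theorem stmt6 (n : ℕ) (hn : 2 ≤ n) (μ : Fin n → ℝ)
    (hμ0 : ∀ j, 0 ≤ μ j) (hμ1 : ∑ j, μ j = 1)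
    (e : Fin n → EuclideanSpace ℝ (Fin n))
    (he : ∀ j, e j = EuclideanSpace.single j (1 : ℝ))
    (v : EuclideanSpace ℝ (Fin n)) (hv : v = ∑ j, μ j • e j)
    (S : Set (EuclideanSpace ℝ (Fin n))) (hS : S = convexHull ℝ (Set.range e))
    (A : Fin n → Set (EuclideanSpace ℝ (Fin n)))
    (hA : ∀ j, A j = convexHull ℝ ((e '' {k | k ≠ j}) ∪ {v})) :
    ∀ j : Fin n,
      Measure.hausdorffMeasure ((n : ℝ) - 1) (A j)
        = ENNReal.ofReal (μ j) * Measure.hausdorffMeasure ((n : ℝ) - 1) S := by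
  intro j
  have : Nontrivial (Fin n) := Fin.nontrivial_iff_two_le.2 hn
  obtain ⟨k, hk⟩ := exists_ne j
  let proj (i : Fin n) : EuclideanSpace ℝ (Fin n) →ₗ[ℝ] ℝ := (EuclideanSpace.proj i).toLinearMap
  let φ : EuclideanSpace ℝ (Fin n) →ₗ[ℝ] ℝ := ∑ i, proj i
  have hφ_apply (x : EuclideanSpace ℝ (Fin n)) : φ x = ∑ i, x i := by
    simp [φ, proj, LinearMap.sum_apply]
  have hφe (i : Fin n) : φ (e i) = 1 := by
    simp [hφ_apply, he]
  have hφ : φ ≠ 0 := fun h => by simpa [h] using hφe j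
  have hφv : φ v = 1 := by
    simp [hv, map_sum, hφe, hμ1]
  have hproj (i : Fin n) : proj j (e i) = if j = i then 1 else 0 := by
    simp [proj, he]
  have hprojv : proj j v = μ j := by
    simp [hv, map_sum, hproj]
  have hS1 : ∀ x ∈ S, φ x = φ (e k) := by
    rw [hS, hφe]
    refine convexHull_min ?_ (convex_hyperplane φ.isLinear 1)
    rintro _ ⟨i, rfl⟩
    exact hφe i
  have hAS : A j = LinearMap.transvection (proj j) (v - e j) '' S := by
    rw [hS, LinearMap.image_convexHull, hA]
    congr 1
    ext x
    simp only [Set.mem_union, Set.mem_image, Set.mem_singleton_iff, Set.mem_range,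
      exists_exists_eq_and, Set.mem_ofPred_eq, LinearMap.transvection.apply, hproj]
    constructor
    · rintro (⟨i, hi, rfl⟩ | rfl)
      · exact ⟨i, by simp [hi.symm]⟩
      · exact ⟨j, by simp⟩
    · rintro ⟨i, rfl⟩
      by_cases hi : i = j
      · right
        simp [hi]
      · exact Or.inl ⟨i, hi, by simp [Ne.symm hi]⟩
  have h := hausdorffMeasure_image_transvection_of_subset_hyperplane hφ (proj j)
    (p := e k) (w := v - e j) (by simp [hφv, hφe]) (by simp [hproj, hk.symm]) hS1
  rw [← hAS, map_sub, hprojv, hproj, if_pos rfl, add_sub_cancel, abs_of_nonneg (hμ0 j),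
    finrank_euclideanSpace_fin] at h
  exact h
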